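/- Every optimal set α of four-means for the condensation measure P satisfies α ∩ [0, 1/5] ≠ ∅, α ∩ [4/5, 1] ≠ ∅, and α ∩ [2/5, 3/5] ≠ ∅; moreover α contains no point of the open interval (1/5, 2/5) and no point of the open interval (3/5, 4/5). -/

import Mathlib

open MeasureTheory Metric Set Filter

/-- The distortion error of a set `α` of quantizer points for `μ`, of order 2:
`∫ min_{a ∈ α} (x - a)^2 dμ(x)`. -/
noncomputable def distortion (μ : MeasureTheory.Measure ℝ) (α : Set ℝ) : ℝ :=
  ∫ x, (Metric.infDist x α) ^ 2 ∂μ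

/-- The `n`th quantization error of order 2 for `μ`. -/
noncomputable def quantErr (μ : MeasureTheory.Measure ℝ) (n : ℕ) : ℝ :=
  sInf {e : ℝ | ∃ α : Set ℝ, α.Finite ∧ α.Nonempty ∧ α.ncard ≤ n ∧ e = distortion μ α}

/-- `α` is an optimal set of `n`-means for `μ`. -/
def IsOptimalSet (μ : MeasureTheory.Measure ℝ) (n : ℕ) (α : Set ℝ) : Prop :=
  α.Finite ∧ α.Nonempty ∧ α.ncard ≤ n ∧ distortion μ α = quantErr μ n

/-- The similarity `S₁(x) = x/5`. -/
noncomputable def S1 : ℝ → ℝ := fun x => x / 5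

/-- The similarity `S₂(x) = x/5 + 4/5`. -/
noncomputable def S2 : ℝ → ℝ := fun x => x / 5 + 4 / 5

/-- `P` is the condensation measure associated with `(S₁, S₂; 1/3, 1/3, 1/3; ν)`:
`P = (1/3) P∘S₁⁻¹ + (1/3) P∘S₂⁻¹ + (1/3) ν`. -/
def IsCondensation (P ν : MeasureTheory.Measure ℝ) : Prop :=
  MeasureTheory.IsProbabilityMeasure P ∧
    P = (1 / 3 : ENNReal) • P.map S1 + (1 / 3 : ENNReal) • P.map S2 + (1 / 3 : ENNReal) • ν

/-- The uniform distribution on `[2/5, 3/5]`, i.e. the measure with density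
`5 · 1_{[2/5, 3/5]}` with respect to Lebesgue measure. -/
noncomputable def nuUnif : MeasureTheory.Measure ℝ :=
  (5 : ENNReal) • (MeasureTheory.volume.restrict (Set.Icc (2 / 5 : ℝ) (3 / 5)))

lemma IsCondensation.measure_abs_sub_gt_le {P : Measure ℝ} (hP : IsCondensation P nuUnif)
    {r : ℝ} (hr : 0 < r) :
    P {x | 1 / 2 + r < |x - 1 / 2|} ≤ (2 / 3 : ENNReal) * P {x | 1 / 2 + 5 * r < |x - 1 / 2|} := by
  have hm : ∀ ρ : ℝ, MeasurableSet {x : ℝ | 1 / 2 + ρ < |x - 1 / 2|} := fun ρ =>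
    (isOpen_lt (by fun_prop) (by fun_prop)).measurableSet
  have h1 : Measurable S1 := by unfold S1; fun_prop
  have h2 : Measurable S2 := by unfold S2; fun_prop
  have hν : nuUnif {x | 1 / 2 + r < |x - 1 / 2|} = 0 := by
    have : {x : ℝ | 1 / 2 + r < |x - 1 / 2|} ∩ Icc (2 / 5 : ℝ) (3 / 5) = ∅ := by
      ext x
      simp only [mem_inter_iff, mem_ofPred_eq, mem_Icc, mem_empty_iff_false, iff_false, not_and]
      rintro h a b
      rcases abs_cases (x - 1 / 2) with ⟨h', _⟩ | ⟨h', _⟩ <;> linarith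
    rw [nuUnif, Measure.smul_apply, Measure.restrict_apply (hm r), this, measure_empty, smul_zero]
  have hsub1 : S1 ⁻¹' {x | 1 / 2 + r < |x - 1 / 2|} ⊆ {x | 1 / 2 + 5 * r < |x - 1 / 2|} := by
    intro x hx
    simp only [mem_preimage, mem_ofPred_eq, S1] at hx ⊢
    rcases abs_cases (x - 1 / 2) with ⟨h', _⟩ | ⟨h', _⟩ <;>
    rcases abs_cases (x / 5 - 1 / 2) with ⟨h'', _⟩ | ⟨h'', _⟩ <;> linarith
  have hsub2 : S2 ⁻¹' {x | 1 / 2 + r < |x - 1 / 2|} ⊆ {x | 1 / 2 + 5 * r < |x - 1 / 2|} := by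
    intro x hx
    simp only [mem_preimage, mem_ofPred_eq, S2] at hx ⊢
    rcases abs_cases (x - 1 / 2) with ⟨h', _⟩ | ⟨h', _⟩ <;>
    rcases abs_cases (x / 5 + 4 / 5 - 1 / 2) with ⟨h'', _⟩ | ⟨h'', _⟩ <;> linarith
  have key := congrArg (fun μ : Measure ℝ => μ {x | 1 / 2 + r < |x - 1 / 2|}) hP.2
  simp only [Measure.add_apply, Measure.smul_apply, smul_eq_mul, hν, mul_zero, add_zero,
    Measure.map_apply h1 (hm r), Measure.map_apply h2 (hm r)] at key
  rw [key]
  calc _ ≤ (1 / 3 : ENNReal) * P {x | 1 / 2 + 5 * r < |x - 1 / 2|}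
        + (1 / 3 : ENNReal) * P {x | 1 / 2 + 5 * r < |x - 1 / 2|} := by
          gcongr
    _ = _ := by
      rw [← add_mul, ENNReal.div_add_div_same]
      norm_num

lemma IsCondensation.measure_abs_sub_gt {P : Measure ℝ} (hP : IsCondensation P nuUnif)
    {r : ℝ} (hr : 0 < r) : P {x | 1 / 2 + r < |x - 1 / 2|} = 0 := by
  have := hP.1
  have hn : ∀ (n : ℕ) (r : ℝ), 0 < r →
      P {x | 1 / 2 + r < |x - 1 / 2|} ≤ (2 / 3 : ENNReal) ^ n := by
    intro n
    induction n with
    | zero => intro r _; simpa using prob_le_one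
    | succ n ih =>
      intro r hr
      refine (hP.measure_abs_sub_gt_le hr).trans ?_
      rw [pow_succ, mul_comm]
      gcongr
      exact ih _ (by linarith)
  have ht : Tendsto (fun n : ℕ => (2 / 3 : ENNReal) ^ n) atTop (nhds 0) :=
    ENNReal.tendsto_pow_atTop_nhds_zero_of_lt_one
      (ENNReal.div_lt_of_lt_mul (by norm_num))
  exact le_antisymm (ge_of_tendsto' ht fun n => hn n r hr) zero_le

lemma IsCondensation.ae_mem_Icc {P : Measure ℝ} (hP : IsCondensation P nuUnif) :
    ∀ᵐ x ∂P, x ∈ Icc (0 : ℝ) 1 := by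
  have h : ∀ᵐ x ∂P, ∀ n : ℕ, ¬ (1 / 2 + 1 / ((n : ℝ) + 1) < |x - 1 / 2|) := by
    rw [ae_all_iff]
    intro n
    rw [ae_iff]
    simpa only [not_not] using hP.measure_abs_sub_gt (r := 1 / ((n : ℝ) + 1)) (by positivity)
  filter_upwards [h] with x hx
  have : |x - 1 / 2| ≤ 1 / 2 := by
    refine le_of_forall_pos_le_add fun ε hε => ?_
    obtain ⟨n, hn⟩ := exists_nat_one_div_lt hε
    have := hx n
    push Not at this
    linarith
  rw [abs_le] at this
  exact ⟨by linarith, by linarith⟩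

lemma IsCondensation.integrable {P : Measure ℝ} (hP : IsCondensation P nuUnif) {f : ℝ → ℝ}
    (hf : Continuous f) : Integrable f P := by
  have := hP.1
  have h := hf.continuousOn.integrableOn_compact (μ := P) (isCompact_Icc (a := (0 : ℝ)) (b := 1))
  rwa [IntegrableOn, Measure.restrict_eq_self_of_ae_mem hP.ae_mem_Icc] at h

lemma IsCondensation.integral_eq {P : Measure ℝ} (hP : IsCondensation P nuUnif) {f : ℝ → ℝ}
    (hf : Continuous f) :
    ∫ x, f x ∂P = 1 / 3 * ((∫ x, f (x / 5) ∂P) + (∫ x, f (x / 5 + 4 / 5) ∂P)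
      + 5 * ∫ x in (2 / 5 : ℝ)..(3 / 5), f x) := by
  have := hP.1
  have h1 : Measurable S1 := by unfold S1; fun_prop
  have h2 : Measurable S2 := by unfold S2; fun_prop
  have e1 : ∫ x, f x ∂(P.map S1) = ∫ x, f (x / 5) ∂P :=
    integral_map h1.aemeasurable hf.aestronglyMeasurable
  have e2 : ∫ x, f x ∂(P.map S2) = ∫ x, f (x / 5 + 4 / 5) ∂P :=
    integral_map h2.aemeasurable hf.aestronglyMeasurable
  have e3 : ∫ x, f x ∂nuUnif = 5 * ∫ x in (2 / 5 : ℝ)..(3 / 5), f x := by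
    rw [nuUnif, integral_smul_measure, intervalIntegral.integral_of_le (by norm_num),
      integral_Icc_eq_integral_Ioc]
    simp
  have hc : (1 / 3 : ENNReal) ≠ ⊤ := by simp
  have i1 : Integrable f (P.map S1) := (integrable_map_measure hf.aestronglyMeasurable
    h1.aemeasurable).2 (hP.integrable (hf.comp (by unfold S1; fun_prop)))
  have i2 : Integrable f (P.map S2) := (integrable_map_measure hf.aestronglyMeasurable
    h2.aemeasurable).2 (hP.integrable (hf.comp (by unfold S2; fun_prop)))
  have i3 : Integrable f nuUnif :=
    Integrable.smul_measure (hf.continuousOn.integrableOn_compact isCompact_Icc) (by simp)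
  conv_lhs => rw [hP.2]
  rw [integral_add_measure ((i1.smul_measure hc).add_measure (i2.smul_measure hc))
    (i3.smul_measure hc), integral_add_measure (i1.smul_measure hc) (i2.smul_measure hc),
    integral_smul_measure, integral_smul_measure, integral_smul_measure, e1, e2, e3]
  simp
  ring

lemma IsCondensation.integral_id {P : Measure ℝ} (hP : IsCondensation P nuUnif) :
    ∫ x, x ∂P = 1 / 2 := by
  have := hP.1
  have h := hP.integral_eq continuous_id
  simp only [id] at h
  rw [integral_add (hP.integrable (by fun_prop)) (hP.integrable (by fun_prop)),
    integral_div, MeasureTheory.integral_const, _root_.integral_id] at h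
  simp at h
  linarith

lemma IsCondensation.integral_sq {P : Measure ℝ} (hP : IsCondensation P nuUnif) :
    ∫ x, x ^ 2 ∂P = 79 / 219 := by
  have := hP.1
  have h := hP.integral_eq (f := fun x => x ^ 2) (by fun_prop)
  have e : ∀ x : ℝ, (x / 5 + 4 / 5) ^ 2 = 1 / 25 * x ^ 2 + (8 / 25 * x + 16 / 25) :=
    fun x => by ring
  simp only [e, div_pow] at h
  rw [integral_add (hP.integrable (by fun_prop)) (hP.integrable (by fun_prop)),
    integral_add (hP.integrable (by fun_prop)) (hP.integrable (by fun_prop)),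
    integral_div, MeasureTheory.integral_const, integral_const_mul, integral_const_mul,
    hP.integral_id, integral_pow] at h
  norm_num at h
  linarith

lemma IsCondensation.integral_affine_sq {P : Measure ℝ} (hP : IsCondensation P nuUnif)
    (p q : ℝ) : ∫ x, (p * x + q) ^ 2 ∂P = p ^ 2 * (79 / 219) + p * q + q ^ 2 := by
  have := hP.1
  have e : ∀ x : ℝ, (p * x + q) ^ 2 = p ^ 2 * x ^ 2 + (2 * p * q * x + q ^ 2) :=
    fun x => by ring
  simp only [e]
  rw [integral_add (hP.integrable (by fun_prop)) (hP.integrable (by fun_prop)),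
    integral_add (hP.integrable (by fun_prop)) (hP.integrable (by fun_prop)),
    MeasureTheory.integral_const, integral_const_mul, integral_const_mul,
    hP.integral_id, hP.integral_sq]
  simp
  ring

lemma IsCondensation.integral_mono {P : Measure ℝ} (hP : IsCondensation P nuUnif)
    {f g : ℝ → ℝ} (hf : Continuous f) (hg : Continuous g) (h : ∀ x ∈ Icc (0 : ℝ) 1, f x ≤ g x) :
    ∫ x, f x ∂P ≤ ∫ x, g x ∂P :=
  integral_mono_ae (hP.integrable hf) (hP.integrable hg) (hP.ae_mem_Icc.mono h)

lemma IsCondensation.le_integral {P : Measure ℝ} (hP : IsCondensation P nuUnif)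
    {f : ℝ → ℝ} (hf : Continuous f) (p q : ℝ) (h : ∀ x ∈ Icc (0 : ℝ) 1, (p * x + q) ^ 2 ≤ f x) :
    p ^ 2 * (79 / 219) + p * q + q ^ 2 ≤ ∫ x, f x ∂P := by
  rw [← hP.integral_affine_sq]
  exact hP.integral_mono (by fun_prop) hf h

lemma IsCondensation.integral_le {P : Measure ℝ} (hP : IsCondensation P nuUnif)
    {f : ℝ → ℝ} (hf : Continuous f) (p q : ℝ) (h : ∀ x ∈ Icc (0 : ℝ) 1, f x ≤ (p * x + q) ^ 2) :
    ∫ x, f x ∂P ≤ p ^ 2 * (79 / 219) + p * q + q ^ 2 := by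
  rw [← hP.integral_affine_sq]
  exact hP.integral_mono hf (by fun_prop) h

/-- Reflection in the midpoint `1/2` preserves the condensation equation. -/
lemma IsCondensation.map_one_sub {P : Measure ℝ} (hP : IsCondensation P nuUnif) :
    IsCondensation (P.map fun x => 1 - x) nuUnif := by
  have := hP.1
  have hr : Measurable fun x : ℝ => 1 - x := by fun_prop
  have h1 : Measurable S1 := by unfold S1; fun_prop
  have h2 : Measurable S2 := by unfold S2; fun_prop
  have hν : nuUnif.map (fun x => 1 - x) = nuUnif := by
    have hpre : (fun x : ℝ => 1 - x) ⁻¹' Icc (2 / 5) (3 / 5) = Icc (2 / 5) (3 / 5) := by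
      ext x
      simp only [mem_preimage, mem_Icc]
      constructor <;> rintro ⟨a, b⟩ <;> constructor <;> linarith
    have := (Measure.measurePreserving_sub_left (volume : Measure ℝ) 1).restrict_preimage
      (measurableSet_Icc (a := (2 / 5 : ℝ)) (b := 3 / 5))
    rw [hpre] at this
    rw [nuUnif, Measure.map_smul, this.map_eq]
  refine ⟨Measure.isProbabilityMeasure_map hr.aemeasurable, ?_⟩
  have c1 : (fun x : ℝ => 1 - x) ∘ S1 = S2 ∘ fun x => 1 - x := by
    funext x; simp only [Function.comp, S1, S2]; ring
  have c2 : (fun x : ℝ => 1 - x) ∘ S2 = S1 ∘ fun x => 1 - x := by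
    funext x; simp only [Function.comp, S1, S2]; ring
  conv_lhs => rw [hP.2]
  rw [Measure.map_add _ _ hr, Measure.map_add _ _ hr, Measure.map_smul, Measure.map_smul,
    Measure.map_smul, hν, Measure.map_map hr h1, Measure.map_map hr h2, c1, c2,
    ← Measure.map_map h2 hr, ← Measure.map_map h1 hr]
  congr 1
  exact add_comm _ _

lemma integral_map_one_sub (P : Measure ℝ) {f : ℝ → ℝ} (hf : Continuous f) :
    ∫ x, f (1 - x) ∂(P.map fun x => 1 - x) = ∫ x, f x ∂P := by
  have h := integral_map (μ := P) (φ := fun x => 1 - x) (f := fun x => f (1 - x)) (by fun_prop)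
    (by fun_prop)
  simpa using h

lemma le_intervalIntegral_of_sq_le {f : ℝ → ℝ} (hf : Continuous f) {l r : ℝ} (p : ℝ) (hlr : l ≤ r)
    (h : ∀ x ∈ Icc l r, (x - p) ^ 2 ≤ f x) :
    ((r - p) ^ 3 - (l - p) ^ 3) / 3 ≤ ∫ x in l..r, f x := by
  have e : ∫ x in l..r, (x - p) ^ 2 = ((r - p) ^ 3 - (l - p) ^ 3) / 3 := by
    rw [intervalIntegral.integral_comp_sub_right (fun x => x ^ 2) p, integral_pow]
    norm_num
  rw [← e]
  exact intervalIntegral.integral_mono_on hlr (Continuous.intervalIntegrable (by fun_prop) _ _)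
    (hf.intervalIntegrable _ _) h

lemma intervalIntegral_le_of_le_mul_sq {f : ℝ → ℝ} (hf : Continuous f) {l r : ℝ} (k p : ℝ)
    (hlr : l ≤ r) (h : ∀ x ∈ Icc l r, f x ≤ k * (x - p) ^ 2) :
    ∫ x in l..r, f x ≤ k * (((r - p) ^ 3 - (l - p) ^ 3) / 3) := by
  have e : ∫ x in l..r, k * (x - p) ^ 2 = k * (((r - p) ^ 3 - (l - p) ^ 3) / 3) := by
    rw [intervalIntegral.integral_const_mul,
      intervalIntegral.integral_comp_sub_right (fun x => x ^ 2) p, integral_pow]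
    norm_num
  rw [← e]
  exact intervalIntegral.integral_mono_on hlr (hf.intervalIntegrable _ _)
    (Continuous.intervalIntegrable (by fun_prop) _ _) h

lemma le_intervalIntegral_of_sq_le_of_sq_le {f : ℝ → ℝ} (hf : Continuous f) {l m r : ℝ} (p q : ℝ)
    (hlm : l ≤ m) (hmr : m ≤ r) (hp : ∀ x ∈ Icc l m, (x - p) ^ 2 ≤ f x)
    (hq : ∀ x ∈ Icc m r, (x - q) ^ 2 ≤ f x) :
    ((m - p) ^ 3 - (l - p) ^ 3) / 3 + ((r - q) ^ 3 - (m - q) ^ 3) / 3 ≤ ∫ x in l..r, f x := by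
  rw [← intervalIntegral.integral_add_adjacent_intervals (hf.intervalIntegrable l m)
    (hf.intervalIntegrable m r)]
  exact add_le_add (le_intervalIntegral_of_sq_le hf p hlm hp)
    (le_intervalIntegral_of_sq_le hf q hmr hq)

lemma sq_sub_le_of_left {x c t : ℝ} (h : t ≤ c) (h' : c + t ≤ 2 * x) :
    (x - c) ^ 2 ≤ (x - t) ^ 2 := by
  nlinarith [mul_nonneg (sub_nonneg.2 h) (sub_nonneg.2 h')]

lemma sq_sub_le_of_right {x c t : ℝ} (h : c ≤ t) (h' : 2 * x ≤ c + t) :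
    (x - c) ^ 2 ≤ (x - t) ^ 2 := by
  nlinarith [mul_nonneg (sub_nonneg.2 h) (sub_nonneg.2 h')]

section UnitScale

variable {P : Measure ℝ} {f : ℝ → ℝ}

lemma IsCondensation.le_integral_of_far_right (hP : IsCondensation P nuUnif) (hf : Continuous f)
    (h : ∀ y ∈ Icc (0 : ℝ) 1, ∃ t, 1 ≤ t ∧ f y = (y - t) ^ 2) : 9 / 25 ≤ ∫ x, f x ∂P := by
  have := hP.le_integral hf 1 (-1) fun y hy => by
    obtain ⟨t, ht, e⟩ := h y hy
    rw [e]
    have := sq_sub_le_of_right ht (x := y) (by linarith [hy.2])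
    nlinarith
  linarith

lemma IsCondensation.le_integral_of_far_left (hP : IsCondensation P nuUnif) (hf : Continuous f)
    (h : ∀ y ∈ Icc (0 : ℝ) 1, ∃ t, t ≤ -1 / 2 ∧ f y = (y - t) ^ 2) : 1 ≤ ∫ x, f x ∂P := by
  have := hP.le_integral hf 1 (1 / 2) fun y hy => by
    obtain ⟨t, ht, e⟩ := h y hy
    rw [e]
    have := sq_sub_le_of_left ht (x := y) (by linarith [hy.1])
    nlinarith
  linarith

lemma IsCondensation.le_integral_of_near_right (hP : IsCondensation P nuUnif) (hf : Continuous f)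
    {s : ℝ} (hs : s ∈ Icc (0 : ℝ) 1)
    (h : ∀ y ∈ Icc (0 : ℝ) 1, ∃ t, (t = s ∨ t ≤ -1) ∧ f y = (y - t) ^ 2) :
    97 / 876 ≤ ∫ x, f x ∂P := by
  have := hP.le_integral hf 1 (-s) fun y hy => by
    obtain ⟨t, ht, e⟩ := h y hy
    rw [e]
    rcases ht with rfl | ht
    · nlinarith
    · have := sq_sub_le_of_left (x := y) (t := t) (c := s) (by linarith [hs.1])
        (by linarith [hs.2, hy.1])
      nlinarith
  nlinarith [sq_nonneg (s - 1 / 2)]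

lemma IsCondensation.le_integral_of_outside_one (hP : IsCondensation P nuUnif)
    (hf : Continuous f) (h : ∀ y ∈ Icc (0 : ℝ) 1, ∃ t, (t ≤ 0 ∨ 1 ≤ t) ∧ f y = (y - t) ^ 2) :
    67 / 1000 ≤ ∫ x, f x ∂P := by
  have h1 := hP.le_integral (f := fun x => f (x / 5)) (by fun_prop) 0 0 fun y hy => by
    obtain ⟨t, -, e⟩ := h (y / 5) ⟨by linarith [hy.1], by linarith [hy.2]⟩
    simp only [e]; nlinarith
  have h2 := hP.le_integral (f := fun x => f (x / 5 + 4 / 5)) (by fun_prop) 0 0 fun y hy => by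
    obtain ⟨t, -, e⟩ := h (y / 5 + 4 / 5) ⟨by linarith [hy.1], by linarith [hy.2]⟩
    simp only [e]; nlinarith
  have h3 := le_intervalIntegral_of_sq_le_of_sq_le hf (l := 2 / 5) (m := 1 / 2) (r := 3 / 5) 0 1
    (by norm_num) (by norm_num)
    (fun x hx => by
      obtain ⟨t, ht, e⟩ := h x ⟨by linarith [hx.1], by linarith [hx.2]⟩
      rw [e]
      rcases ht with ht | ht
      · exact sq_sub_le_of_left ht (by linarith [hx.1])
      · exact sq_sub_le_of_right (by linarith) (by linarith [hx.2]))
    (fun x hx => by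
      obtain ⟨t, ht, e⟩ := h x ⟨by linarith [hx.1], by linarith [hx.2]⟩
      rw [e]
      rcases ht with ht | ht
      · exact sq_sub_le_of_left (by linarith) (by linarith [hx.1])
      · exact sq_sub_le_of_right ht (by linarith [hx.2]))
  rw [hP.integral_eq hf]
  norm_num at h1 h2 h3
  linarith

lemma IsCondensation.le_integral_of_outside (hP : IsCondensation P nuUnif)
    (hf : Continuous f) {w : ℝ} (hw : 3 / 2 ≤ w) (hw' : w ≤ 9 / 5)
    (h : ∀ y ∈ Icc (0 : ℝ) 1, ∃ t, (t ≤ 0 ∨ w ≤ t) ∧ f y = (y - t) ^ 2) :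
    (19 / 75 + (w - 1) ^ 2) / 3 ≤ ∫ x, f x ∂P := by
  have h1 := hP.le_integral (f := fun x => f (x / 5)) (by fun_prop) 0 0 fun y hy => by
    obtain ⟨t, -, e⟩ := h (y / 5) ⟨by linarith [hy.1], by linarith [hy.2]⟩
    simp only [e]; nlinarith
  have h2 := hP.le_integral (f := fun x => f (x / 5 + 4 / 5)) (by fun_prop) 0 (w - 1)
    fun y hy => by
      obtain ⟨t, ht, e⟩ := h (y / 5 + 4 / 5) ⟨by linarith [hy.1], by linarith [hy.2]⟩
      simp only [e]
      rcases ht with ht | ht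
      · nlinarith [hy.1]
      · nlinarith [hy.2]
  have h3 := le_intervalIntegral_of_sq_le hf (l := 2 / 5) (r := 3 / 5) 0 (by norm_num)
    (fun x hx => by
      obtain ⟨t, ht, e⟩ := h x ⟨by linarith [hx.1], by linarith [hx.2]⟩
      rw [e]
      rcases ht with ht | ht
      · exact sq_sub_le_of_left ht (by linarith [hx.1])
      · exact sq_sub_le_of_right (by linarith) (by linarith [hx.2]))
  rw [hP.integral_eq hf]
  norm_num at h1 h2 h3
  linarith

lemma IsCondensation.le_integral_of_one_point (hP : IsCondensation P nuUnif)
    (hf : Continuous f) {s : ℝ}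
    (h : ∀ y ∈ Icc (0 : ℝ) 1, ∃ t, (t = s ∨ 3 / 2 ≤ t) ∧ f y = (y - t) ^ 2) :
    84 / 1000 ≤ ∫ x, f x ∂P := by
  have c1 : Continuous fun x => f (x / 5) := by fun_prop
  have c2 : Continuous fun x => f (x / 5 + 4 / 5) := by fun_prop
  have k1 : ∀ y ∈ Icc (0 : ℝ) 1, ∃ t, (t = s ∨ 3 / 2 ≤ t) ∧ f (y / 5) = (y / 5 - t) ^ 2 :=
    fun y hy => h _ ⟨by linarith [hy.1], by linarith [hy.2]⟩
  have k2 : ∀ y ∈ Icc (0 : ℝ) 1, ∃ t, (t = s ∨ 3 / 2 ≤ t) ∧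
      f (y / 5 + 4 / 5) = (y / 5 + 4 / 5 - t) ^ 2 :=
    fun y hy => h _ ⟨by linarith [hy.1], by linarith [hy.2]⟩
  have k3 : ∀ y ∈ Icc (2 / 5 : ℝ) (3 / 5), ∃ t, (t = s ∨ 3 / 2 ≤ t) ∧ f y = (y - t) ^ 2 :=
    fun y hy => h _ ⟨by linarith [hy.1], by linarith [hy.2]⟩
  rw [hP.integral_eq hf]
  rcases lt_or_ge s 0 with hs | hs
  · have h1 := hP.le_integral c1 0 0 fun y hy => by
      obtain ⟨t, -, e⟩ := k1 y hy
      simp only [e]; nlinarith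
    have h2 := hP.le_integral c2 0 (1 / 2) fun y hy => by
      obtain ⟨t, rfl | ht, e⟩ := k2 y hy
      · simp only [e]; nlinarith [hy.1]
      · simp only [e]; nlinarith [hy.2]
    have h3 := le_intervalIntegral_of_sq_le hf (l := 2 / 5) (r := 3 / 5) 0 (by norm_num)
      (fun x hx => by
        obtain ⟨t, rfl | ht, e⟩ := k3 x hx <;> rw [e]
        · exact sq_sub_le_of_left hs.le (by linarith [hx.1])
        · exact sq_sub_le_of_right (by linarith) (by linarith [hx.2]))
    norm_num at h1 h2 h3
    linarith
  rcases le_or_gt s (4 / 5) with hs' | hs'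
  · have h1 := hP.le_integral c1 (1 / 5) (-s) fun y hy => by
      obtain ⟨t, rfl | ht, e⟩ := k1 y hy <;> simp only [e]
      · nlinarith
      · have := sq_sub_le_of_right (x := y / 5) (c := s) (t := t) (by linarith) (by linarith [hy.2])
        nlinarith
    have h3 := le_intervalIntegral_of_sq_le hf (l := 2 / 5) (r := 3 / 5) s (by norm_num)
      (fun x hx => by
        obtain ⟨t, rfl | ht, e⟩ := k3 x hx <;> rw [e]
        exact sq_sub_le_of_right (by linarith) (by linarith [hx.2]))
    rcases le_or_gt s (3 / 10) with hs3 | hs3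
    · have h2 := hP.le_integral c2 0 (1 / 2) fun y hy => by
        obtain ⟨t, rfl | ht, e⟩ := k2 y hy
        · simp only [e]; nlinarith [hy.1]
        · simp only [e]; nlinarith [hy.2]
      nlinarith [sq_nonneg (s - 3 / 10)]
    · have h2 := hP.le_integral c2 0 (4 / 5 - s) fun y hy => by
        obtain ⟨t, rfl | ht, e⟩ := k2 y hy
        · simp only [e]; nlinarith [hy.1]
        · simp only [e]; nlinarith [hy.2]
      nlinarith [sq_nonneg (s - 7 / 15)]
  · have h1 := hP.le_integral c1 0 (3 / 5) fun y hy => by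
      obtain ⟨t, rfl | ht, e⟩ := k1 y hy
      · simp only [e]; nlinarith [hy.2]
      · simp only [e]; nlinarith [hy.2]
    have h2 := hP.le_integral c2 0 0 fun y hy => by
      obtain ⟨t, -, e⟩ := k2 y hy
      simp only [e]; nlinarith
    have h3 := le_intervalIntegral_of_sq_le hf (l := 2 / 5) (r := 3 / 5) (4 / 5) (by norm_num)
      (fun x hx => by
        obtain ⟨t, rfl | ht, e⟩ := k3 x hx <;> rw [e]
        · exact sq_sub_le_of_right hs'.le (by linarith [hx.2])
        · exact sq_sub_le_of_right (by linarith) (by linarith [hx.2]))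
    norm_num at h1 h2 h3
    linarith

lemma IsCondensation.le_integral_of_one_point' (hP : IsCondensation P nuUnif)
    (hf : Continuous f) {s : ℝ}
    (h : ∀ y ∈ Icc (0 : ℝ) 1, ∃ t, (t = s ∨ t ≤ -1 / 2) ∧ f y = (y - t) ^ 2) :
    84 / 1000 ≤ ∫ x, f x ∂P := by
  rw [← integral_map_one_sub P hf]
  refine hP.map_one_sub.le_integral_of_one_point (s := 1 - s) (by fun_prop) fun y hy => ?_
  obtain ⟨t, ht, e⟩ := h (1 - y) ⟨by linarith [hy.2], by linarith [hy.1]⟩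
  refine ⟨1 - t, ht.imp (fun h => by rw [h]) (fun h => by linarith), ?_⟩
  rw [e]; ring

lemma IsCondensation.le_integral_of_one_inside (hP : IsCondensation P nuUnif)
    (hf : Continuous f) {s : ℝ} (hs : s ∈ Icc (0 : ℝ) 1)
    (h : ∀ y ∈ Icc (0 : ℝ) 1, ∃ t, (t = s ∨ 1 ≤ t) ∧ f y = (y - t) ^ 2) :
    31 / 1000 ≤ ∫ x, f x ∂P := by
  have c1 : Continuous fun x => f (x / 5) := by fun_prop
  have c2 : Continuous fun x => f (x / 5 + 4 / 5) := by fun_prop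
  have k1 : ∀ y ∈ Icc (0 : ℝ) 1, ∃ t, (t = s ∨ 1 ≤ t) ∧ f (y / 5) = (y / 5 - t) ^ 2 :=
    fun y hy => h _ ⟨by linarith [hy.1], by linarith [hy.2]⟩
  have k2 : ∀ y ∈ Icc (0 : ℝ) 1, ∃ t, (t = s ∨ 1 ≤ t) ∧
      f (y / 5 + 4 / 5) = (y / 5 + 4 / 5 - t) ^ 2 :=
    fun y hy => h _ ⟨by linarith [hy.1], by linarith [hy.2]⟩
  have k3 : ∀ y ∈ Icc (2 / 5 : ℝ) (3 / 5), ∃ t, (t = s ∨ 1 ≤ t) ∧ f y = (y - t) ^ 2 :=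
    fun y hy => h _ ⟨by linarith [hy.1], by linarith [hy.2]⟩
  have h1' := hP.le_integral c1 0 0 fun y hy => by
    obtain ⟨t, -, e⟩ := k1 y hy
    simp only [e]; nlinarith
  have h2' := hP.le_integral c2 0 0 fun y hy => by
    obtain ⟨t, -, e⟩ := k2 y hy
    simp only [e]; nlinarith
  rw [hP.integral_eq hf]
  rcases lt_or_ge s (1 / 5) with hs1 | hs1
  · have h3 := le_intervalIntegral_of_sq_le hf (l := 2 / 5) (r := 3 / 5) (1 / 5) (by norm_num)
      (fun x hx => by
        obtain ⟨t, rfl | ht, e⟩ := k3 x hx <;> rw [e]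
        · exact sq_sub_le_of_left hs1.le (by linarith [hx.1])
        · exact sq_sub_le_of_right (by linarith) (by linarith [hx.2]))
    norm_num at h1' h2' h3
    linarith
  have h1 := hP.le_integral c1 (1 / 5) (-s) fun y hy => by
    obtain ⟨t, rfl | ht, e⟩ := k1 y hy <;> simp only [e]
    · nlinarith
    · have := sq_sub_le_of_right (x := y / 5) (c := s) (t := t) (by linarith [hs.2])
        (by linarith [hy.2])
      nlinarith
  have h3 := le_intervalIntegral_of_sq_le hf (l := 2 / 5) (r := 3 / 5) s (by norm_num)
    (fun x hx => by
      obtain ⟨t, rfl | ht, e⟩ := k3 x hx <;> rw [e]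
      exact sq_sub_le_of_right (by linarith [hs.2]) (by linarith [hx.2]))
  rcases le_or_gt s (3 / 5) with hs3 | hs3
  · have h2 := hP.le_integral c2 (1 / 5) (-1 / 5) fun y hy => by
      obtain ⟨t, rfl | ht, e⟩ := k2 y hy <;> simp only [e]
      · have := sq_sub_le_of_left (x := y / 5 + 4 / 5) (c := 1) (t := t) (by linarith)
          (by linarith [hy.1])
        nlinarith
      · have := sq_sub_le_of_right (x := y / 5 + 4 / 5) (c := 1) (t := t) (by linarith)
          (by linarith [hy.2])
        nlinarith
    nlinarith [sq_nonneg (s - 3 / 10)]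
  · nlinarith [sq_nonneg (s - 3 / 10)]

end UnitScale

section Centre

variable {f : ℝ → ℝ}

lemma le_integral_centre_of_one_point (hf : Continuous f) {c : ℝ}
    (h : ∀ x ∈ Icc (2 / 5 : ℝ) (3 / 5), ∃ t, (t ≤ 3 / 10 ∨ 7 / 10 ≤ t ∨ t = c) ∧
      f x = (x - t) ^ 2) : 1 / 1500 ≤ ∫ x in (2 / 5 : ℝ)..(3 / 5), f x := by
  obtain ⟨c', hc1, hc2, hc⟩ : ∃ c', 2 / 5 ≤ c' ∧ c' ≤ 3 / 5 ∧
      ∀ x ∈ Icc (2 / 5 : ℝ) (3 / 5), (x - c') ^ 2 ≤ (x - c) ^ 2 := by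
    rcases lt_or_ge c (2 / 5) with h1 | h1
    · exact ⟨2 / 5, by norm_num, by norm_num, fun x hx =>
        sq_sub_le_of_left h1.le (by linarith [hx.1])⟩
    rcases lt_or_ge (3 / 5) c with h2 | h2
    · exact ⟨3 / 5, by norm_num, by norm_num, fun x hx =>
        sq_sub_le_of_right h2.le (by linarith [hx.2])⟩
    exact ⟨c, h1, h2, fun _ _ => le_rfl⟩
  rcases le_total c' (1 / 2) with h5 | h5
  · have := le_intervalIntegral_of_sq_le_of_sq_le hf (l := 2 / 5) (m := (c' + 7 / 10) / 2)
      (r := 3 / 5) c' (7 / 10) (by linarith) (by linarith)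
      (fun x hx => by
        have hx' : x ∈ Icc (2 / 5 : ℝ) (3 / 5) := ⟨hx.1, by linarith [hx.2]⟩
        obtain ⟨t, ht | ht | rfl, e⟩ := h x hx' <;> rw [e]
        · exact sq_sub_le_of_left (by linarith) (by linarith [hx.1])
        · exact sq_sub_le_of_right (by linarith) (by linarith [hx.2])
        · exact hc x hx')
      (fun x hx => by
        have hx' : x ∈ Icc (2 / 5 : ℝ) (3 / 5) := ⟨by linarith [hx.1], hx.2⟩
        obtain ⟨t, ht | ht | rfl, e⟩ := h x hx' <;> rw [e]
        · nlinarith [hx.1]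
        · exact sq_sub_le_of_right (by linarith) (by linarith [hx.2])
        · exact (sq_sub_le_of_left (by linarith) (by linarith [hx.1])).trans (hc x hx'))
    nlinarith [mul_nonneg (sub_nonneg.2 h5) (sub_nonneg.2 hc1), sq_nonneg (c' - 1 / 2),
      mul_nonneg (sq_nonneg (c' - 1 / 2)) (sub_nonneg.2 hc1)]
  · have := le_intervalIntegral_of_sq_le_of_sq_le hf (l := 2 / 5) (m := (c' + 3 / 10) / 2)
      (r := 3 / 5) (3 / 10) c' (by linarith) (by linarith)
      (fun x hx => by
        have hx' : x ∈ Icc (2 / 5 : ℝ) (3 / 5) := ⟨hx.1, by linarith [hx.2]⟩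
        obtain ⟨t, ht | ht | rfl, e⟩ := h x hx' <;> rw [e]
        · exact sq_sub_le_of_left (by linarith) (by linarith [hx.1])
        · nlinarith [hx.2]
        · exact (sq_sub_le_of_right (by linarith) (by linarith [hx.2])).trans (hc x hx'))
      (fun x hx => by
        have hx' : x ∈ Icc (2 / 5 : ℝ) (3 / 5) := ⟨by linarith [hx.1], hx.2⟩
        obtain ⟨t, ht | ht | rfl, e⟩ := h x hx' <;> rw [e]
        · exact sq_sub_le_of_left (by linarith) (by linarith [hx.1])
        · exact sq_sub_le_of_right (by linarith) (by linarith [hx.2])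
        · exact hc x hx')
    nlinarith [mul_nonneg (sub_nonneg.2 h5) (sub_nonneg.2 hc2), sq_nonneg (c' - 1 / 2),
      mul_nonneg (sq_nonneg (c' - 1 / 2)) (sub_nonneg.2 hc2)]

lemma le_integral_centre_of_two_points (hf : Continuous f) {c : ℝ}
    (hc : c ∈ Icc (2 / 5 : ℝ) (3 / 5))
    (h : ∀ x ∈ Icc (2 / 5 : ℝ) (3 / 5), ∃ t, (t ≤ 2 / 5 ∨ 4 / 5 ≤ t ∨ t = c) ∧
      f x = (x - t) ^ 2) : 29 / 100000 ≤ ∫ x in (2 / 5 : ℝ)..(3 / 5), f x := by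
  have := le_intervalIntegral_of_sq_le_of_sq_le hf (l := 2 / 5) (m := (c + 2 / 5) / 2)
    (r := 3 / 5) (2 / 5) c (by linarith [hc.1]) (by linarith [hc.2])
    (fun x hx => by
      obtain ⟨t, ht | ht | rfl, e⟩ := h x ⟨hx.1, by linarith [hx.2, hc.2]⟩ <;> rw [e]
      · exact sq_sub_le_of_left (by linarith) (by linarith [hx.1])
      · exact sq_sub_le_of_right (by linarith) (by linarith [hx.2, hc.2])
      · exact sq_sub_le_of_right (by linarith [hc.1]) (by linarith [hx.2]))
    (fun x hx => by
      obtain ⟨t, ht | ht | rfl, e⟩ := h x ⟨by linarith [hx.1, hc.1], hx.2⟩ <;> rw [e]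
      · exact sq_sub_le_of_left (by linarith [hc.1]) (by linarith [hx.1])
      · exact sq_sub_le_of_right (by linarith [hc.2]) (by linarith [hx.2, hc.1]))
  obtain ⟨h1, h2⟩ := hc
  nlinarith [mul_nonneg (sub_nonneg.2 h1) (sq_nonneg (c - 8 / 15)),
    mul_nonneg (sub_nonneg.2 h2) (sq_nonneg (c - 8 / 15)), sq_nonneg (c - 8 / 15)]

lemma le_integral_centre_of_forall_le (hf : Continuous f) {k : ℝ}
    (h : ∀ x ∈ Icc (2 / 5 : ℝ) (3 / 5), k ≤ f x) :
    k / 5 ≤ ∫ x in (2 / 5 : ℝ)..(3 / 5), f x := by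
  have := intervalIntegral.integral_mono_on (μ := volume) (a := (2 / 5 : ℝ)) (b := 3 / 5)
    (by norm_num) (intervalIntegrable_const (c := k)) (hf.intervalIntegrable _ _) h
  rw [intervalIntegral.integral_const, smul_eq_mul] at this
  linarith

lemma le_integral_centre_of_outside (hf : Continuous f) {a b : ℝ} (ha : 3 / 10 ≤ a)
    (ha' : a ≤ 2 / 5) (hb : 3 / 5 ≤ b) (hb' : b ≤ 7 / 10)
    (h : ∀ x ∈ Icc (2 / 5 : ℝ) (3 / 5), ∃ t, (t ≤ a ∨ b ≤ t) ∧ f x = (x - t) ^ 2) :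
    (((b - a) / 2) ^ 3 * 2 - (2 / 5 - a) ^ 3 - (b - 3 / 5) ^ 3) / 3
      ≤ ∫ x in (2 / 5 : ℝ)..(3 / 5), f x := by
  have := le_intervalIntegral_of_sq_le_of_sq_le hf (l := 2 / 5) (m := (a + b) / 2)
    (r := 3 / 5) a b (by linarith) (by linarith)
    (fun x hx => by
      obtain ⟨t, ht | ht, e⟩ := h x ⟨hx.1, by linarith [hx.2]⟩ <;> rw [e]
      · exact sq_sub_le_of_left (by linarith) (by linarith [hx.1])
      · exact sq_sub_le_of_right (by linarith) (by linarith [hx.2]))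
    (fun x hx => by
      obtain ⟨t, ht | ht, e⟩ := h x ⟨by linarith [hx.1], hx.2⟩ <;> rw [e]
      · exact sq_sub_le_of_left (by linarith) (by linarith [hx.1])
      · exact sq_sub_le_of_right (by linarith) (by linarith [hx.2]))
  refine le_trans (le_of_eq ?_) this
  ring

end Centre

lemma exists_infDist_sq_eq {α : Set ℝ} (hfin : α.Finite) (hne : α.Nonempty) (x : ℝ) :
    ∃ a ∈ α, infDist x α ^ 2 = (x - a) ^ 2 := by
  obtain ⟨a, ha, h⟩ := hfin.isCompact.exists_infDist_eq_dist hne x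
  exact ⟨a, ha, by rw [h, Real.dist_eq, sq_abs]⟩

lemma infDist_sq_le {α : Set ℝ} {a : ℝ} (ha : a ∈ α) (x : ℝ) :
    infDist x α ^ 2 ≤ (x - a) ^ 2 := by
  rw [← sq_abs (x - a), ← Real.dist_eq]
  exact pow_le_pow_left₀ infDist_nonneg (infDist_le_dist_of_mem ha) 2

lemma continuous_infDist_sq (α : Set ℝ) : Continuous fun x => infDist x α ^ 2 :=
  (continuous_infDist_pt α).pow 2

lemma Set.Finite.eq_of_ncard_le_four {α : Set ℝ} (hfin : α.Finite) (hcard : α.ncard ≤ 4)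
    {x y z w : ℝ} (hx : x ∈ α) (hy : y ∈ α) (hz : z ∈ α) (hw : w ∈ α) (hxy : x ≠ y) (hxz : x ≠ z)
    (hxw : x ≠ w) (hyz : y ≠ z) (hyw : y ≠ w) (hzw : z ≠ w) :
    ∀ v ∈ α, v = x ∨ v = y ∨ v = z ∨ v = w := by
  have h4 : ({x, y, z, w} : Set ℝ).ncard = 4 := by
    rw [Set.ncard_insert_of_notMem (by simp [hxy, hxz, hxw]),
      Set.ncard_insert_of_notMem (by simp [hyz, hyw]), Set.ncard_pair hzw]
  have hsub : ({x, y, z, w} : Set ℝ) ⊆ α := by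
    simp [Set.insert_subset_iff, hx, hy, hz, hw]
  have := Set.eq_of_subset_of_ncard_le hsub (by rw [h4]; exact hcard) hfin
  intro v hv
  rw [← this] at hv
  simpa using hv

lemma exists_pair_of_not_exists {α : Set ℝ} {p : ℝ → Prop}
    (h : ¬ ∃ b, ∀ x ∈ α, p x ∨ x = b) : ∃ x ∈ α, ∃ y ∈ α, x ≠ y ∧ ¬ p x ∧ ¬ p y := by
  push Not at h
  obtain ⟨x, hx, hpx, -⟩ := h 0
  obtain ⟨y, hy, hpy, hyx⟩ := h x
  exact ⟨x, hx, y, hy, hyx.symm, hpx, hpy⟩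

/-- Three times the distortion, with respect to the condensation measure, of the set
`{13/300, 47/300, 1/2, 9/10}`. -/
noncomputable def fourMeansBound : ℝ :=
  (97 / 876 - 289 / 3600 + 97 / 876) / 25 + 1 / 300

lemma IsCondensation.distortion_eq {P : Measure ℝ} (hP : IsCondensation P nuUnif) (α : Set ℝ) :
    distortion P α = 1 / 3 * ((∫ x, infDist (x / 5) α ^ 2 ∂P)
      + (∫ x, infDist (x / 5 + 4 / 5) α ^ 2 ∂P)
      + 5 * ∫ x in (2 / 5 : ℝ)..(3 / 5), infDist x α ^ 2) :=
  hP.integral_eq (continuous_infDist_sq α)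

lemma IsCondensation.quantErr_four_le {P : Measure ℝ} (hP : IsCondensation P nuUnif) :
    3 * quantErr P 4 ≤ fourMeansBound := by
  set β : Set ℝ := {13 / 300, 47 / 300, 1 / 2, 9 / 10} with hβ
  have hq : quantErr P 4 ≤ distortion P β := by
    refine csInf_le ⟨0, ?_⟩ ⟨β, by simp [hβ], by simp [hβ], ?_, rfl⟩
    · rintro e ⟨γ, -, -, -, rfl⟩
      exact integral_nonneg fun x => by positivity
    · refine (Set.ncard_insert_le _ _).trans ?_
      have := Set.ncard_insert_le (47 / 300 : ℝ) {1 / 2, 9 / 10}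
      have := Set.ncard_insert_le (1 / 2 : ℝ) {9 / 10}
      have := Set.ncard_singleton (9 / 10 : ℝ)
      omega
  have hc := continuous_infDist_sq β
  have m1 : (13 / 300 : ℝ) ∈ β := by simp [hβ]
  have m2 : (47 / 300 : ℝ) ∈ β := by simp [hβ]
  have m3 : (1 / 2 : ℝ) ∈ β := by simp [hβ]
  have m4 : (9 / 10 : ℝ) ∈ β := by simp [hβ]
  have hB := hP.integral_le (f := fun x => infDist (x / 5 + 4 / 5) β ^ 2) (by fun_prop)
    (1 / 5) (-1 / 10) fun x _ => (infDist_sq_le m4 _).trans (by nlinarith)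
  have hC := intervalIntegral_le_of_le_mul_sq hc (l := 2 / 5) (r := 3 / 5) 1 (1 / 2)
    (by norm_num) fun x _ => (infDist_sq_le m3 _).trans (by nlinarith)
  have hcA : Continuous fun x : ℝ => infDist (x / 5) β ^ 2 := by fun_prop
  have hA := hP.integral_eq hcA
  have hA1 := hP.integral_le (f := fun x => infDist (x / 5 / 5) β ^ 2) (by fun_prop)
    (1 / 25) (-13 / 300) fun x _ => (infDist_sq_le m1 _).trans (by nlinarith)
  have hA2 := hP.integral_le (f := fun x => infDist ((x / 5 + 4 / 5) / 5) β ^ 2) (by fun_prop)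
    (1 / 25) (1 / 300) fun x _ => (infDist_sq_le m2 _).trans (by nlinarith)
  have hA3 := intervalIntegral_le_of_le_mul_sq hcA (l := 2 / 5) (r := 1 / 2) (1 / 25) (13 / 60)
    (by norm_num) fun x _ => (infDist_sq_le m1 _).trans (by nlinarith)
  have hA4 := intervalIntegral_le_of_le_mul_sq hcA (l := 1 / 2) (r := 3 / 5) (1 / 25) (47 / 60)
    (by norm_num) fun x _ => (infDist_sq_le m2 _).trans (by nlinarith)
  rw [← intervalIntegral.integral_add_adjacent_intervals (hcA.intervalIntegrable (2 / 5) (1 / 2))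
    (hcA.intervalIntegrable (1 / 2) (3 / 5))] at hA
  rw [hP.distortion_eq] at hq
  unfold fourMeansBound
  norm_num at hA1 hA2 hA3 hA4 hB hC
  linarith

section OneSided

variable {P : Measure ℝ} {α : Set ℝ}

lemma IsCondensation.le_integral_left (hP : IsCondensation P nuUnif) {k : ℝ}
    (h : k ≤ ∫ x, 25 * infDist (x / 5) α ^ 2 ∂P) :
    k / 25 ≤ ∫ x, infDist (x / 5) α ^ 2 ∂P := by
  have := hP.1
  rw [integral_const_mul] at h
  linarith

lemma IsCondensation.le_integral_right (hP : IsCondensation P nuUnif) {k : ℝ}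
    (h : k ≤ ∫ x, 25 * infDist (x / 5 + 4 / 5) α ^ 2 ∂P) :
    k / 25 ≤ ∫ x, infDist (x / 5 + 4 / 5) α ^ 2 ∂P := by
  have := hP.1
  rw [integral_const_mul] at h
  linarith

lemma exists_left_sq_eq (hfin : α.Finite) (hne : α.Nonempty) {T : ℝ → Prop}
    (hT : ∀ a ∈ α, T (5 * a)) (y : ℝ) :
    ∃ t, T t ∧ 25 * infDist (y / 5) α ^ 2 = (y - t) ^ 2 := by
  obtain ⟨a, ha, e⟩ := exists_infDist_sq_eq hfin hne (y / 5)
  exact ⟨5 * a, hT a ha, by rw [e]; ring⟩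

lemma exists_right_sq_eq (hfin : α.Finite) (hne : α.Nonempty) {T : ℝ → Prop}
    (hT : ∀ a ∈ α, T (5 * a - 4)) (y : ℝ) :
    ∃ t, T t ∧ 25 * infDist (y / 5 + 4 / 5) α ^ 2 = (y - t) ^ 2 := by
  obtain ⟨a, ha, e⟩ := exists_infDist_sq_eq hfin hne (y / 5 + 4 / 5)
  exact ⟨5 * a - 4, hT a ha, by rw [e]; ring⟩

lemma exists_centre_sq_eq (hfin : α.Finite) (hne : α.Nonempty) {T : ℝ → Prop}
    (hT : ∀ a ∈ α, T a) (y : ℝ) :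
    ∃ t, T t ∧ infDist y α ^ 2 = (y - t) ^ 2 := by
  obtain ⟨a, ha, e⟩ := exists_infDist_sq_eq hfin hne y
  exact ⟨a, hT a ha, e⟩

lemma continuous_left_infDist_sq (α : Set ℝ) :
    Continuous fun y : ℝ => 25 * infDist (y / 5) α ^ 2 := by
  have := continuous_infDist_sq α
  fun_prop

lemma continuous_right_infDist_sq (α : Set ℝ) :
    Continuous fun y : ℝ => 25 * infDist (y / 5 + 4 / 5) α ^ 2 := by
  have := continuous_infDist_sq α
  fun_prop

lemma IsCondensation.le_left_of_one_point (hP : IsCondensation P nuUnif) (hfin : α.Finite)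
    (hne : α.Nonempty) {a : ℝ} (h : ∀ x ∈ α, 3 / 10 ≤ x ∨ x = a) :
    84 / 25000 ≤ ∫ x, infDist (x / 5) α ^ 2 ∂P := by
  have := hP.le_integral_left (hP.le_integral_of_one_point (continuous_left_infDist_sq α)
    (s := 5 * a) fun y _ => exists_left_sq_eq hfin hne
      (fun x hx => (h x hx).symm.imp (fun h => by rw [h]) (fun h => by linarith)) y)
  linarith

lemma IsCondensation.le_right_of_one_point (hP : IsCondensation P nuUnif) (hfin : α.Finite)
    (hne : α.Nonempty) {a : ℝ} (h : ∀ x ∈ α, x ≤ 7 / 10 ∨ x = a) :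
    84 / 25000 ≤ ∫ x, infDist (x / 5 + 4 / 5) α ^ 2 ∂P := by
  have := hP.le_integral_right (hP.le_integral_of_one_point' (continuous_right_infDist_sq α)
    (s := 5 * a - 4) fun y _ => exists_right_sq_eq hfin hne
      (fun x hx => (h x hx).symm.imp (fun h => by rw [h]) (fun h => by linarith)) y)
  linarith

lemma IsCondensation.le_right_of_forall_le (hP : IsCondensation P nuUnif) (hfin : α.Finite)
    (hne : α.Nonempty) (h : ∀ x ∈ α, x ≤ 7 / 10) :
    1 / 25 ≤ ∫ x, infDist (x / 5 + 4 / 5) α ^ 2 ∂P :=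
  hP.le_integral_right (hP.le_integral_of_far_left (continuous_right_infDist_sq α)
    fun y _ => exists_right_sq_eq hfin hne (fun x hx => by linarith [h x hx]) y)

lemma inter_left_nonempty (hP : IsCondensation P nuUnif) (hfin : α.Finite) (hne : α.Nonempty)
    (hcard : α.ncard ≤ 4)
    (hle : (∫ x, infDist (x / 5) α ^ 2 ∂P) + (∫ x, infDist (x / 5 + 4 / 5) α ^ 2 ∂P)
      + 5 * (∫ x in (2 / 5 : ℝ)..(3 / 5), infDist x α ^ 2) ≤ fourMeansBound) :
    (α ∩ Icc (0 : ℝ) (1 / 5)).Nonempty := by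
  by_contra hemp
  rw [Set.not_nonempty_iff_eq_empty] at hemp
  have hout : ∀ a ∈ α, a < 0 ∨ 1 / 5 < a := by
    intro a ha
    by_contra! h
    have : a ∈ α ∩ Icc (0 : ℝ) (1 / 5) := ⟨ha, h.1, h.2⟩
    rwa [hemp] at this
  have hA0 : 0 ≤ ∫ x, infDist (x / 5) α ^ 2 ∂P := integral_nonneg fun x => by positivity
  have hB0 : 0 ≤ ∫ x, infDist (x / 5 + 4 / 5) α ^ 2 ∂P := integral_nonneg fun x => by positivity
  have hC0 : 0 ≤ ∫ x in (2 / 5 : ℝ)..(3 / 5), infDist x α ^ 2 :=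
    intervalIntegral.integral_nonneg (by norm_num) fun x _ => by positivity
  have hc := continuous_infDist_sq α
  unfold fourMeansBound at hle
  obtain ⟨l, hl, hl0⟩ : ∃ l ∈ α, l < 0 := by
    by_contra! h
    have := hP.le_integral_left (hP.le_integral_of_far_right (continuous_left_infDist_sq α)
      fun y _ => exists_left_sq_eq hfin hne (fun a ha => by
        rcases hout a ha with h' | h' <;> linarith [h a ha]) y)
    linarith
  by_cases hp : ∃ p ∈ α, 1 / 5 < p ∧ p < 3 / 10
  · obtain ⟨p, hpα, hp1, hp2⟩ := hp
    have hA := hP.le_integral_left (hP.le_integral_of_outside_one (continuous_left_infDist_sq α)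
      fun y _ => exists_left_sq_eq hfin hne (T := fun t => t ≤ 0 ∨ 1 ≤ t) (fun a ha =>
        (hout a ha).imp (fun h => by linarith) (fun h => by linarith)) y)
    by_cases h2 : ∃ b, ∀ x ∈ α, x ≤ 7 / 10 ∨ x = b
    · obtain ⟨b, hb⟩ := h2
      have hB := hP.le_right_of_one_point hfin hne hb
      by_cases h3 : ∃ c, ∀ x ∈ α, (x ≤ 3 / 10 ∨ 7 / 10 ≤ x) ∨ x = c
      · obtain ⟨c, h3⟩ := h3
        have hC := le_integral_centre_of_one_point hc (c := c) fun y _ =>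
          exists_centre_sq_eq hfin hne (fun a ha => or_assoc.1 (h3 a ha)) y
        linarith
      · obtain ⟨x, hx, y, hy, hxy, hx', hy'⟩ := exists_pair_of_not_exists h3
        push Not at hx' hy'
        have h4 := hfin.eq_of_ncard_le_four hcard hl hpα hx hy (by linarith)
          (by linarith [hx'.1]) (by linarith [hy'.1]) (by linarith [hx'.1])
          (by linarith [hy'.1]) hxy
        have := hP.le_right_of_forall_le hfin hne fun v hv => by
          rcases h4 v hv with rfl | rfl | rfl | rfl <;> linarith
        linarith
    · obtain ⟨x, hx, y, hy, hxy, hx', hy'⟩ := exists_pair_of_not_exists h2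
      push Not at hx' hy'
      have h4 := hfin.eq_of_ncard_le_four hcard hl hpα hx hy (by linarith)
        (by linarith) (by linarith) (by linarith) (by linarith) hxy
      have := le_integral_centre_of_forall_le hc (k := 1 / 100) fun z hz => by
        obtain ⟨a, ha, e⟩ := exists_infDist_sq_eq hfin hne z
        rw [e]
        rcases h4 a ha with rfl | rfl | rfl | rfl <;> nlinarith [hz.1, hz.2]
      linarith
  · push Not at hp
    have hout' : ∀ a ∈ α, a < 0 ∨ 3 / 10 ≤ a := fun a ha => (hout a ha).imp_right (hp a ha)
    have hA := hP.le_integral_left (hP.le_integral_of_outside (continuous_left_infDist_sq α)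
      (w := 3 / 2) le_rfl (by norm_num)
      fun y _ => exists_left_sq_eq hfin hne (T := fun t => t ≤ 0 ∨ 3 / 2 ≤ t) (fun a ha =>
        (hout' a ha).imp (fun h => by linarith) (fun h => by linarith)) y)
    by_cases h2 : ∃ b, ∀ x ∈ α, x ≤ 7 / 10 ∨ x = b
    · obtain ⟨b, hb⟩ := h2
      have hB := hP.le_right_of_one_point hfin hne hb
      linarith
    obtain ⟨x, hx, y, hy, hxy, hx', hy'⟩ := exists_pair_of_not_exists h2
    push Not at hx' hy'
    by_cases hz : ∃ z ∈ α, 3 / 10 ≤ z ∧ z < 7 / 20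
    · obtain ⟨z, hz, hz1, hz2⟩ := hz
      have h4 := hfin.eq_of_ncard_le_four hcard hl hz hx hy (by linarith)
        (by linarith) (by linarith) (by linarith) (by linarith) hxy
      have := le_integral_centre_of_forall_le hc (k := 1 / 400) fun u hu => by
        obtain ⟨a, ha, e⟩ := exists_infDist_sq_eq hfin hne u
        rw [e]
        rcases h4 a ha with rfl | rfl | rfl | rfl <;> nlinarith [hu.1, hu.2]
      linarith
    · push Not at hz
      have hA := hP.le_integral_left (hP.le_integral_of_outside (continuous_left_infDist_sq α)
        (w := 7 / 4) (by norm_num) (by norm_num)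
        fun y _ => exists_left_sq_eq hfin hne (T := fun t => t ≤ 0 ∨ 7 / 4 ≤ t) (fun a ha =>
          (hout' a ha).imp (fun h => by linarith) (fun h => by linarith [hz a ha h])) y)
      linarith

lemma inter_centre_nonempty (hP : IsCondensation P nuUnif) (hfin : α.Finite) (hne : α.Nonempty)
    (hcard : α.ncard ≤ 4)
    (hle : (∫ x, infDist (x / 5) α ^ 2 ∂P) + (∫ x, infDist (x / 5 + 4 / 5) α ^ 2 ∂P)
      + 5 * (∫ x in (2 / 5 : ℝ)..(3 / 5), infDist x α ^ 2) ≤ fourMeansBound) :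
    (α ∩ Icc (2 / 5 : ℝ) (3 / 5)).Nonempty := by
  by_contra hemp
  rw [Set.not_nonempty_iff_eq_empty] at hemp
  have hout : ∀ a ∈ α, a < 2 / 5 ∨ 3 / 5 < a := by
    intro a ha
    by_contra! h
    have : a ∈ α ∩ Icc (2 / 5 : ℝ) (3 / 5) := ⟨ha, h.1, h.2⟩
    rwa [hemp] at this
  have hA0 : 0 ≤ ∫ x, infDist (x / 5) α ^ 2 ∂P := integral_nonneg fun x => by positivity
  have hB0 : 0 ≤ ∫ x, infDist (x / 5 + 4 / 5) α ^ 2 ∂P := integral_nonneg fun x => by positivity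
  have hc := continuous_infDist_sq α
  have hC := le_integral_centre_of_outside hc (a := 2 / 5) (b := 3 / 5) (by norm_num) le_rfl
    le_rfl (by norm_num) fun y _ => exists_centre_sq_eq hfin hne
      (T := fun t => t ≤ 2 / 5 ∨ 3 / 5 ≤ t) (fun a ha => (hout a ha).imp le_of_lt le_of_lt) y
  unfold fourMeansBound at hle
  obtain ⟨p, hp, hp1, hp2⟩ : ∃ p ∈ α, 3 / 10 < p ∧ p < 2 / 5 := by
    by_contra! h
    have := le_integral_centre_of_outside hc (a := 3 / 10) (b := 3 / 5) le_rfl (by norm_num)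
      le_rfl (by norm_num) fun y _ => exists_centre_sq_eq hfin hne
        (T := fun t => t ≤ 3 / 10 ∨ 3 / 5 ≤ t) (fun a ha => by
          rcases hout a ha with h' | h'
          · left
            by_contra! h''
            linarith [h a ha h'']
          · exact Or.inr h'.le) y
    linarith
  obtain ⟨q, hq, hq1, hq2⟩ : ∃ q ∈ α, 3 / 5 < q ∧ q < 7 / 10 := by
    by_contra! h
    have := le_integral_centre_of_outside hc (a := 2 / 5) (b := 7 / 10) (by norm_num) le_rfl
      (by norm_num) le_rfl fun y _ => exists_centre_sq_eq hfin hne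
        (T := fun t => t ≤ 2 / 5 ∨ 7 / 10 ≤ t) (fun a ha =>
          (hout a ha).imp le_of_lt (h a ha)) y
    linarith
  by_cases h2 : ∃ b, ∀ x ∈ α, x ≤ 7 / 10 ∨ x = b
  · obtain ⟨b, hb⟩ := h2
    have hB := hP.le_right_of_one_point hfin hne hb
    by_cases h1 : ∃ a, ∀ x ∈ α, 3 / 10 ≤ x ∨ x = a
    · obtain ⟨a, ha⟩ := h1
      have hA := hP.le_left_of_one_point hfin hne ha
      linarith
    · obtain ⟨x, hx, y, hy, hxy, hx', hy'⟩ := exists_pair_of_not_exists h1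
      push Not at hx' hy'
      have h4 := hfin.eq_of_ncard_le_four hcard hp hq hx hy (by linarith)
        (by linarith) (by linarith) (by linarith) (by linarith) hxy
      have := hP.le_right_of_forall_le hfin hne fun v hv => by
        rcases h4 v hv with rfl | rfl | rfl | rfl <;> linarith
      linarith
  · obtain ⟨x, hx, y, hy, hxy, hx', hy'⟩ := exists_pair_of_not_exists h2
    push Not at hx' hy'
    have h4 := hfin.eq_of_ncard_le_four hcard hp hq hx hy (by linarith)
      (by linarith) (by linarith) (by linarith) (by linarith) hxy
    have := hP.le_integral_left (hP.le_integral_of_far_right (continuous_left_infDist_sq α)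
      fun y _ => exists_left_sq_eq hfin hne (fun a ha => by
        rcases h4 a ha with rfl | rfl | rfl | rfl <;> linarith) y)
    linarith

lemma inter_left_gap_eq_empty (hP : IsCondensation P nuUnif) (hfin : α.Finite) (hne : α.Nonempty)
    (hcard : α.ncard ≤ 4)
    (hle : (∫ x, infDist (x / 5) α ^ 2 ∂P) + (∫ x, infDist (x / 5 + 4 / 5) α ^ 2 ∂P)
      + 5 * (∫ x in (2 / 5 : ℝ)..(3 / 5), infDist x α ^ 2) ≤ fourMeansBound)
    (hJ : (α ∩ Icc (4 / 5 : ℝ) 1).Nonempty) :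
    α ∩ Ioo (1 / 5 : ℝ) (2 / 5) = ∅ := by
  obtain ⟨a, ha, ha0, ha1⟩ := inter_left_nonempty hP hfin hne hcard hle
  obtain ⟨c, hcα, hc0, hc1⟩ := inter_centre_nonempty hP hfin hne hcard hle
  obtain ⟨b, hb, hb0, hb1⟩ := hJ
  by_contra hg
  obtain ⟨g, hg, hg0, hg1⟩ := Set.nonempty_iff_ne_empty.2 hg
  have h4 := hfin.eq_of_ncard_le_four hcard ha hg hcα hb (by linarith) (by linarith)
    (by linarith) (by linarith) (by linarith) (by linarith)
  have hc := continuous_infDist_sq α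
  have hB := hP.le_integral_right (hP.le_integral_of_near_right (continuous_right_infDist_sq α)
    (s := 5 * b - 4) ⟨by linarith, by linarith⟩
    fun y _ => exists_right_sq_eq hfin hne (T := fun t => t = 5 * b - 4 ∨ t ≤ -1) (fun v hv => by
      rcases h4 v hv with rfl | rfl | rfl | rfl
      · right; linarith
      · right; linarith
      · right; linarith
      · left; rfl) y)
  unfold fourMeansBound at hle
  rcases le_or_gt g (3 / 10) with hg3 | hg3
  · have hA := hP.le_integral_left (hP.le_integral_of_one_inside (continuous_left_infDist_sq α)
      (s := 5 * a) ⟨by linarith, by linarith⟩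
      fun y _ => exists_left_sq_eq hfin hne (T := fun t => t = 5 * a ∨ 1 ≤ t) (fun v hv => by
        rcases h4 v hv with rfl | rfl | rfl | rfl
        · left; rfl
        · right; linarith
        · right; linarith
        · right; linarith) y)
    have hC := le_integral_centre_of_one_point hc (c := c) fun y _ =>
      exists_centre_sq_eq hfin hne (T := fun t => t ≤ 3 / 10 ∨ 7 / 10 ≤ t ∨ t = c) (fun v hv => by
        rcases h4 v hv with rfl | rfl | rfl | rfl
        · left; linarith
        · left; linarith
        · right; right; rfl
        · right; left; linarith) y
    linarith
  · have hA := hP.le_left_of_one_point hfin hne (a := a) fun v hv => by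
      rcases h4 v hv with rfl | rfl | rfl | rfl
      · right; rfl
      · left; linarith
      · left; linarith
      · left; linarith
    have hC := le_integral_centre_of_two_points hc (c := c) ⟨hc0, hc1⟩ fun y _ =>
      exists_centre_sq_eq hfin hne (T := fun t => t ≤ 2 / 5 ∨ 4 / 5 ≤ t ∨ t = c) (fun v hv => by
        rcases h4 v hv with rfl | rfl | rfl | rfl
        · left; linarith
        · left; linarith
        · right; right; rfl
        · right; left; linarith) y
    linarith

end OneSided

lemma distortion_map_one_sub (P : Measure ℝ) (α : Set ℝ) :
    distortion (P.map fun x => 1 - x) ((fun x => 1 - x) '' α) = distortion P α := by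
  unfold distortion
  rw [← integral_map_one_sub P (continuous_infDist_sq α)]
  congr 1
  funext x
  have h := infDist_image (Φ := fun x : ℝ => 1 - x) (x := 1 - x) (t := α)
    (Isometry.of_dist_eq fun x y => by rw [dist_sub_left])
  simp only [sub_sub_cancel] at h
  rw [h]

theorem optimal_four_means_structure_uniform (P : MeasureTheory.Measure ℝ)
    (hP : IsCondensation P nuUnif) :
    ∀ α : Set ℝ, IsOptimalSet P 4 α →
      (α ∩ Set.Icc (0 : ℝ) (1 / 5)).Nonempty ∧
      (α ∩ Set.Icc (4 / 5 : ℝ) 1).Nonempty ∧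
      (α ∩ Set.Icc (2 / 5 : ℝ) (3 / 5)).Nonempty ∧
      α ∩ Set.Ioo (1 / 5 : ℝ) (2 / 5) = ∅ ∧
      α ∩ Set.Ioo (3 / 5 : ℝ) (4 / 5) = ∅ := by
  rintro α ⟨hfin, hne, hcard, hopt⟩
  have hle : 3 * distortion P α ≤ fourMeansBound := hopt ▸ hP.quantErr_four_le
  have hinj : Function.Injective fun x : ℝ => 1 - x := sub_right_injective
  have hle' := hle
  rw [← distortion_map_one_sub, hP.map_one_sub.distortion_eq] at hle'
  rw [hP.distortion_eq] at hle
  have hcard' : ((fun x : ℝ => 1 - x) '' α).ncard ≤ 4 := by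
    rwa [Set.ncard_image_of_injective _ hinj]
  have hL := inter_left_nonempty hP hfin hne hcard (by linarith)
  have hR : (α ∩ Icc (4 / 5 : ℝ) 1).Nonempty := by
    obtain ⟨_, ⟨a, ha, rfl⟩, h0, h1⟩ := inter_left_nonempty hP.map_one_sub (hfin.image _)
      (hne.image _) hcard' (by linarith)
    exact ⟨a, ha, by linarith, by linarith⟩
  refine ⟨hL, hR, inter_centre_nonempty hP hfin hne hcard (by linarith),
    inter_left_gap_eq_empty hP hfin hne hcard (by linarith) hR, ?_⟩
  have hgap := inter_left_gap_eq_empty hP.map_one_sub (hfin.image _) (hne.image _) hcard'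
    (by linarith) (by
      obtain ⟨a, ha, h0, h1⟩ := hL
      exact ⟨1 - a, ⟨a, ha, rfl⟩, by linarith, by linarith⟩)
  by_contra h
  obtain ⟨g, hg, h0, h1⟩ := Set.nonempty_iff_ne_empty.2 h
  have : 1 - g ∈ (fun x : ℝ => 1 - x) '' α ∩ Ioo (1 / 5 : ℝ) (2 / 5) :=
    ⟨⟨g, hg, rfl⟩, by linarith, by linarith⟩
  rwa [hgap] at this
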